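/- arXiv:2002.00027 — 4 statements merged into one kernel-verified Lean document; each statement's English description precedes it below -/
import Mathlib

section
/- If T(x) ≠ x for some state x ∈ {−1,+1}^N, then E(T(x)) < E(x). That is, the energy of the bipolar recurrent correlation neural network strictly decreases at every non-stationary synchronous update. -/
open scoped Classical

/-- Correlation of the state `x` with the `ξ`-th fundamental memory. -/
noncomputable def overlap {N P : ℕ} (u : Fin P → Fin N → ℝ) (x : Fin N → ℝ) (ξ : Fin P) : ℝ :=
  ∑ i, u ξ i * x i

/-- Activation potential of the `i`-th neuron: `h_i(x) = Σ_ξ f(Σ_j u_j^ξ x_j) u_i^ξ`. -/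
noncomputable def pot {N P : ℕ} (f : ℝ → ℝ) (u : Fin P → Fin N → ℝ) (x : Fin N → ℝ)
    (i : Fin N) : ℝ :=
  ∑ ξ, f (overlap u x ξ) * u ξ i

/-- Synchronous update of the bipolar recurrent correlation neural network. -/
noncomputable def upd {N P : ℕ} (f : ℝ → ℝ) (u : Fin P → Fin N → ℝ) (x : Fin N → ℝ) :
    Fin N → ℝ :=
  fun i => if pot f u x i ≠ 0 then Real.sign (pot f u x i) else x i

/-- Energy of the bipolar recurrent correlation neural network. -/
noncomputable def energy {N P : ℕ} (F : ℝ → ℝ) (u : Fin P → Fin N → ℝ) (x : Fin N → ℝ) : ℝ :=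
  -∑ ξ, F (overlap u x ξ)

theorem tangent_aux (f F : ℝ → ℝ) (hmono : Monotone f)
    (hF : ∀ t : ℝ, HasDerivAt F (f t) t) (a b : ℝ) : f a * (b - a) ≤ F b - F a := by
  have hc : Continuous F := continuous_iff_continuousAt.2 fun t => (hF t).continuousAt
  rcases lt_trichotomy a b with h | h | h
  · obtain ⟨c, hc1, hc2⟩ := exists_hasDerivAt_eq_slope F f h hc.continuousOn (fun t _ => hF t)
    have h1 := hmono hc1.1.le
    rw [eq_div_iff (by linarith)] at hc2
    rw [← hc2]
    exact mul_le_mul_of_nonneg_right h1 (by linarith)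
  · simp [h]
  · obtain ⟨c, hc1, hc2⟩ := exists_hasDerivAt_eq_slope F f h hc.continuousOn (fun t _ => hF t)
    have h1 := hmono hc1.2.le
    rw [eq_div_iff (by linarith)] at hc2
    nlinarith [mul_le_mul_of_nonneg_right h1 (by linarith : 0 ≤ a - b)]

/-- The energy of the bipolar RCNN strictly decreases at every non-stationary
synchronous update. -/
theorem bipolar_energy_decreases_sync {N P : ℕ} (hN : 1 ≤ N) (hP : 1 ≤ P)
    (f F : ℝ → ℝ) (hf : Continuous f) (hmono : Monotone f)
    (hF : ∀ t : ℝ, HasDerivAt F (f t) t)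
    (u : Fin P → Fin N → ℝ) (hu : ∀ ξ i, u ξ i = 1 ∨ u ξ i = -1)
    (x : Fin N → ℝ) (hx : ∀ i, x i = 1 ∨ x i = -1)
    (hne : upd f u x ≠ x) :
    energy F u (upd f u x) < energy F u x := by
  have key : ∑ ξ, f (overlap u x ξ) * (overlap u (upd f u x) ξ - overlap u x ξ)
      = ∑ i, pot f u x i * (upd f u x i - x i) := by
    simp only [overlap, pot, ← Finset.sum_sub_distrib, Finset.mul_sum, Finset.sum_mul]
    rw [Finset.sum_comm]
    refine Finset.sum_congr rfl fun i _ => Finset.sum_congr rfl fun ξ _ => ?_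
    ring
  have hle : ∑ ξ, f (overlap u x ξ) * (overlap u (upd f u x) ξ - overlap u x ξ)
      ≤ ∑ ξ, (F (overlap u (upd f u x) ξ) - F (overlap u x ξ)) :=
    Finset.sum_le_sum fun ξ _ => tangent_aux f F hmono hF _ _
  have hterm : ∀ i, 0 ≤ pot f u x i * (upd f u x i - x i) ∧
      (upd f u x i ≠ x i → 0 < pot f u x i * (upd f u x i - x i)) := by
    intro i
    rcases lt_trichotomy (pot f u x i) 0 with h | h | h
    · have e : upd f u x i = -1 := by simp [upd, h.ne, Real.sign_of_neg h]
      rw [e]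
      rcases hx i with hi | hi <;> rw [hi]
      · exact ⟨by linarith, fun _ => by linarith⟩
      · simp
    · simp [upd, h]
    · have e : upd f u x i = 1 := by simp [upd, h.ne', Real.sign_of_pos h]
      rw [e]
      rcases hx i with hi | hi <;> rw [hi]
      · simp
      · exact ⟨by linarith, fun _ => by linarith⟩
  obtain ⟨i, hi⟩ := Function.ne_iff.1 hne
  have hpos : 0 < ∑ i, pot f u x i * (upd f u x i - x i) :=
    Finset.sum_pos' (fun i _ => (hterm i).1) ⟨i, Finset.mem_univ i, (hterm i).2 hi⟩
  rw [Finset.sum_sub_distrib] at hle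
  unfold energy
  linarith
end

section
/- The complex-valued multistate signum function csgn is a B-function on the complex numbers with the natural conjugation: for every z ∈ D and every s ∈ S with s ≠ csgn(z), one has Re(conj(csgn(z))·z) > Re(conj(s)·z). -/
open scoped Classical

/-- The argument of a complex number taken in `[0, 2π)`. -/
noncomputable def arg2pi (z : ℂ) : ℝ :=
  if Complex.arg z < 0 then Complex.arg z + 2 * Real.pi else Complex.arg z

/-- The domain `D` of the complex-valued multistate signum function: nonzero complex
numbers whose argument (in `[0, 2π)`) differs from `(2k-1)·Δθ` for all `k = 1,…,K`,
where `Δθ = π/K`. -/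
def Dset (K : ℕ) : Set ℂ :=
  {z | z ≠ 0 ∧ ∀ k : ℕ, 1 ≤ k → k ≤ K → arg2pi z ≠ (2 * (k : ℝ) - 1) * (Real.pi / K)}

/-- The set `S = {e^{2kΔθ·i} : k = 0,…,K-1}` of `K`-th roots of unity, `Δθ = π/K`. -/
def Sset (K : ℕ) : Set ℂ :=
  {s | ∃ k : ℕ, k < K ∧ s = Complex.exp ((2 * (k : ℝ) * (Real.pi / K) : ℝ) * Complex.I)}

/-- `csgn` is a complex-valued multistate signum function with resolution factor `K`:
for every `z ∈ D`, `csgn z` is the element `s ∈ S` such that the argument of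
`z · conj s` lies in the open interval `(-Δθ, Δθ)` modulo `2π`. -/
def IsCsgn (K : ℕ) (csgn : ℂ → ℂ) : Prop :=
  ∀ z ∈ Dset K, csgn z ∈ Sset K ∧
    Complex.arg (z * (starRingEnd ℂ) (csgn z)) ∈ Set.Ioo (-(Real.pi / K)) (Real.pi / K)

theorem cos_aux (K : ℕ) (hK : 1 < K) (φ : ℝ) (h1 : -(Real.pi / K) < φ) (h2 : φ < Real.pi / K)
    (n : ℝ) (hn1 : 1 ≤ n) (hn2 : n + 1 ≤ K) :
    Real.cos (φ + 2 * n * (Real.pi / K)) < Real.cos φ := by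
  have hK0 : (0 : ℝ) < K := by positivity
  set d := Real.pi / K with hd
  have hdp : 0 < d := div_pos Real.pi_pos hK0
  have hpi : K * d = Real.pi := by rw [hd]; field_simp
  have e : Real.cos (φ + 2 * n * d) - Real.cos φ
      = -2 * Real.sin (φ + n * d) * Real.sin (n * d) := by
    rw [Real.cos_sub_cos]
    congr 2
    · congr 2; ring
    · congr 1; ring
  have hm1 : d ≤ n * d := by nlinarith
  have hm2 : n * d + d ≤ Real.pi := by nlinarith
  have s1 : 0 < Real.sin (φ + n * d) := Real.sin_pos_of_pos_of_lt_pi (by linarith) (by linarith)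
  have s2 : 0 < Real.sin (n * d) := Real.sin_pos_of_pos_of_lt_pi (by linarith) (by linarith)
  nlinarith [mul_pos s1 s2]

/-- The complex-valued multistate signum function is a `B`-function on the complex
numbers with the natural conjugation. -/
theorem csgn_isBFunction (K : ℕ) (hK : 1 < K) (csgn : ℂ → ℂ) (hcsgn : IsCsgn K csgn)
    (z : ℂ) (hz : z ∈ Dset K) (s : ℂ) (hs : s ∈ Sset K) (hne : s ≠ csgn z) :
    ((starRingEnd ℂ) s * z).re < ((starRingEnd ℂ) (csgn z) * z).re := by
  obtain ⟨⟨m, hm, hc⟩, ha1, ha2⟩ := hcsgn z hz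
  obtain ⟨k, hk, rfl⟩ := hs
  have hz0 := hz.1
  generalize csgn z = c at *
  have hmk : k ≠ m := by
    rintro rfl
    exact hne hc.symm
  subst hc
  set a : ℝ := 2 * (m : ℝ) * (Real.pi / K) with ha
  set b : ℝ := 2 * (k : ℝ) * (Real.pi / K) with hb
  have hconj : ∀ t : ℝ, (starRingEnd ℂ) (Complex.exp (t * Complex.I))
      = Complex.exp ((-t : ℝ) * Complex.I) := by
    intro t
    rw [← Complex.exp_conj]
    simp
  rw [hconj] at ha1 ha2 ⊢
  rw [hconj]
  set w := z * Complex.exp ((-a : ℝ) * Complex.I) with hw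
  have hw0 : 0 < ‖w‖ := norm_pos_iff.mpr (mul_ne_zero hz0 (Complex.exp_ne_zero _))
  have hpol := Complex.norm_mul_exp_arg_mul_I w
  have key : Complex.exp ((-b : ℝ) * Complex.I) * z
      = (‖w‖ : ℂ) * Complex.exp ((w.arg + (a - b) : ℝ) * Complex.I) := by
    have h3 : Complex.exp ((w.arg + (a - b) : ℝ) * Complex.I)
      = Complex.exp (w.arg * Complex.I) * Complex.exp ((a - b : ℝ) * Complex.I) := by
      rw [← Complex.exp_add]; congr 1; push_cast; ring
    rw [h3, ← mul_assoc, hpol, hw, mul_assoc, ← Complex.exp_add, mul_comm]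
    congr 2; push_cast; ring
  have key2 : Complex.exp ((-a : ℝ) * Complex.I) * z
      = (‖w‖ : ℂ) * Complex.exp ((w.arg : ℝ) * Complex.I) := by
    rw [hpol, hw, mul_comm]
  rw [key, key2, Complex.re_ofReal_mul, Complex.re_ofReal_mul, Complex.exp_ofReal_mul_I_re,
    Complex.exp_ofReal_mul_I_re]
  apply mul_lt_mul_of_pos_left _ hw0
  rcases lt_or_gt_of_ne hmk with h | h
  · have := cos_aux K hK w.arg ha1 ha2 ((m : ℝ) - k)
      (by have : (k : ℝ) + 1 ≤ m := by exact_mod_cast h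
          linarith)
      (by have : (m : ℝ) + 1 ≤ K := by exact_mod_cast hm
          have : (0 : ℝ) ≤ k := by positivity
          linarith)
    refine lt_of_eq_of_lt (congrArg Real.cos ?_) this
    rw [ha, hb]; ring
  · have := cos_aux K hK (-w.arg) (by linarith) (by linarith) ((k : ℝ) - m)
      (by have : (m : ℝ) + 1 ≤ k := by exact_mod_cast h
          linarith)
      (by have : (k : ℝ) + 1 ≤ K := by exact_mod_cast hk
          have : (0 : ℝ) ≤ m := by positivity
          linarith)
    rw [Real.cos_neg, ← Real.cos_neg (-w.arg + _)] at this
    refine lt_of_eq_of_lt (congrArg Real.cos ?_) this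
    rw [ha, hb]; ring
end

section
/- The twin-multistate activation function tsgn is a B-function on the quaternions with the natural conjugation: for every quaternion q with z₀(q) ∈ D and z₁(q) ∈ D, and every quaternion s with z₀(s) ∈ S and z₁(s) ∈ S and s ≠ tsgn(q), one has Re_ℍ(conj(tsgn(q))·q) > Re_ℍ(conj(s)·q). -/
open scoped Classical

/-- The complex number `z₀(q) = q₀ + q₁ i` built from the first two components of a
quaternion `q = q₀ + q₁ i + q₂ j + q₃ k`. -/
def z0 (q : Quaternion ℝ) : ℂ := ⟨q.re, q.imI⟩

/-- The complex number `z₁(q) = q₂ + q₃ i` built from the last two components of a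
quaternion `q = q₀ + q₁ i + q₂ j + q₃ k`, so that `q = z₀(q) + z₁(q)·j`. -/
def z1 (q : Quaternion ℝ) : ℂ := ⟨q.imJ, q.imK⟩

/-- The quaternion `a + b·j` built from two complex numbers `a` and `b`. -/
def ofC (a b : ℂ) : Quaternion ℝ := ⟨a.re, a.im, b.re, b.im⟩

/-- The twin-multistate activation function `tsgn(q) = csgn(z₀ q) + csgn(z₁ q)·j`. -/
def tsgn (csgn : ℂ → ℂ) (q : Quaternion ℝ) : Quaternion ℝ :=
  ofC (csgn (z0 q)) (csgn (z1 q))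

theorem aux_cos (K k l : ℕ) (hk : k < K) (hl : l < K) (h : l ≠ k) (φ : ℝ)
    (h1 : -(Real.pi / K) < φ) (h2 : φ < Real.pi / K) :
    Real.cos (φ + (2 * (l : ℝ) * (Real.pi / K) - 2 * (k : ℝ) * (Real.pi / K))) < Real.cos φ := by
  have hK : (0 : ℝ) < K := by exact_mod_cast (by omega : 0 < K)
  obtain ⟨δ, hδ⟩ : ∃ δ, δ = Real.pi / K := ⟨_, rfl⟩
  rw [← hδ] at h1 h2 ⊢
  have hpi : Real.pi = K * δ := by rw [hδ]; field_simp
  have hδ0 : 0 < δ := by rw [hδ]; positivity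
  have key : Real.cos φ - Real.cos (φ + (2 * (l : ℝ) * δ - 2 * (k : ℝ) * δ))
      = 2 * (Real.sin (φ + (l - k) * δ) * Real.sin ((l - k) * δ)) := by
    rw [Real.cos_sub_cos,
      show (φ + (φ + (2 * (l : ℝ) * δ - 2 * (k : ℝ) * δ))) / 2 = φ + (l - k) * δ by ring,
      show (φ - (φ + (2 * (l : ℝ) * δ - 2 * (k : ℝ) * δ))) / 2 = -((l - k) * δ) by ring,
      Real.sin_neg]
    ring
  have hk0 : (0 : ℝ) ≤ k := Nat.cast_nonneg k
  have hl0 : (0 : ℝ) ≤ l := Nat.cast_nonneg l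
  have hk' : (k : ℝ) + 1 ≤ K := by exact_mod_cast hk
  have hl' : (l : ℝ) + 1 ≤ K := by exact_mod_cast hl
  have a1 : ((l : ℝ) - k) * δ ≤ (K - 1) * δ := mul_le_mul_of_nonneg_right (by linarith) hδ0.le
  have a2 : ((k : ℝ) - l) * δ ≤ (K - 1) * δ := mul_le_mul_of_nonneg_right (by linarith) hδ0.le
  suffices 0 < Real.sin (φ + (l - k) * δ) * Real.sin ((l - k) * δ) by linarith
  rcases lt_or_gt_of_ne h with h | h
  · have h' : (l : ℝ) + 1 ≤ k := by exact_mod_cast h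
    have a3 : 1 * δ ≤ ((k : ℝ) - l) * δ := by gcongr; linarith
    apply mul_pos_of_neg_of_neg <;> apply Real.sin_neg_of_neg_of_neg_pi_lt <;> linarith
  · have h' : (k : ℝ) + 1 ≤ l := by exact_mod_cast h
    have a3 : 1 * δ ≤ ((l : ℝ) - k) * δ := by gcongr; linarith
    apply mul_pos <;> apply Real.sin_pos_of_pos_of_lt_pi <;> linarith

theorem aux_lt (K : ℕ) (z c s : ℂ) (hz : z ≠ 0) (hc : c ∈ Sset K) (hs : s ∈ Sset K)
    (harg : Complex.arg (z * (starRingEnd ℂ) c) ∈ Set.Ioo (-(Real.pi / K)) (Real.pi / K))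
    (hne : s ≠ c) :
    (z * (starRingEnd ℂ) s).re < (z * (starRingEnd ℂ) c).re := by
  obtain ⟨l, hl, hc⟩ := hc
  obtain ⟨k, hk, hs⟩ := hs
  have hlk : l ≠ k := by rintro rfl; exact hne (hs.trans hc.symm)
  have hc0 : c ≠ 0 := by rw [hc]; exact Complex.exp_ne_zero _
  have hlt := aux_cos K k l hk hl hlk _ harg.1 harg.2
  obtain ⟨w, hw⟩ : ∃ w, w = z * (starRingEnd ℂ) c := ⟨_, rfl⟩
  have hw0 : w ≠ 0 := by rw [hw]; exact mul_ne_zero hz (by simpa using hc0)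
  rw [← hw] at hlt ⊢
  have e1 : z * (starRingEnd ℂ) s = (‖w‖ : ℂ) * Complex.exp
      ((Complex.arg w + (2 * (l : ℝ) * (Real.pi / K) - 2 * (k : ℝ) * (Real.pi / K)) : ℝ) * Complex.I) := by
    have : z * (starRingEnd ℂ) s = w * (c * (starRingEnd ℂ) s) := by
      have : (starRingEnd ℂ) c * c = 1 := by
        rw [hc, ← Complex.exp_conj, ← Complex.exp_add]
        simp only [map_mul, Complex.conj_ofReal, Complex.conj_I]
        rw [mul_neg, neg_add_cancel, Complex.exp_zero]
      rw [hw]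
      linear_combination (-z * (starRingEnd ℂ) s) * this
    rw [this]
    conv_lhs => rw [← Complex.norm_mul_exp_arg_mul_I w]
    rw [hc, hs, ← Complex.exp_conj, mul_assoc, ← Complex.exp_add, ← Complex.exp_add]
    congr 2
    simp only [map_mul, Complex.conj_ofReal, Complex.conj_I]
    push_cast
    ring
  have e2 : w.re = ‖w‖ * Real.cos (Complex.arg w) := (Complex.norm_mul_cos_arg w).symm
  rw [e1, e2, Complex.re_ofReal_mul, Complex.exp_ofReal_mul_I_re]
  exact mul_lt_mul_of_pos_left hlt (norm_pos_iff.mpr hw0)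

theorem aux_re (s q : Quaternion ℝ) : (star s * q).re =
    (z0 q * (starRingEnd ℂ) (z0 s)).re + (z1 q * (starRingEnd ℂ) (z1 s)).re := by
  simp [z0, z1]
  ring

/-- The twin-multistate activation function is a `B`-function on the quaternions with
the natural conjugation. -/
theorem tsgn_isBFunction (K : ℕ) (hK : 1 < K) (csgn : ℂ → ℂ) (hcsgn : IsCsgn K csgn)
    (q : Quaternion ℝ) (hq0 : z0 q ∈ Dset K) (hq1 : z1 q ∈ Dset K)
    (s : Quaternion ℝ) (hs0 : z0 s ∈ Sset K) (hs1 : z1 s ∈ Sset K)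
    (hne : s ≠ tsgn csgn q) :
    (star s * q).re < (star (tsgn csgn q) * q).re := by
  obtain ⟨c0, a0⟩ := hcsgn _ hq0
  obtain ⟨c1, a1⟩ := hcsgn _ hq1
  rw [aux_re, aux_re]
  have t0 : z0 (tsgn csgn q) = csgn (z0 q) := rfl
  have t1 : z1 (tsgn csgn q) = csgn (z1 q) := rfl
  rw [t0, t1]
  have L0 := aux_lt K _ _ _ hq0.1 c0 hs0 a0
  have L1 := aux_lt K _ _ _ hq1.1 c1 hs1 a1
  by_cases e0 : z0 s = csgn (z0 q)
  · by_cases e1 : z1 s = csgn (z1 q)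
    · exfalso
      apply hne
      rw [← t0] at e0
      rw [← t1] at e1
      have b1 := congrArg Complex.re e0
      have b2 := congrArg Complex.im e0
      have b3 := congrArg Complex.re e1
      have b4 := congrArg Complex.im e1
      exact QuaternionAlgebra.ext b1 b2 b3 b4
    · rw [e0]
      linarith [L1 e1]
  · by_cases e1 : z1 s = csgn (z1 q)
    · rw [e1]
      linarith [L0 e0]
    · linarith [L0 e0, L1 e1]
end

section
/- The complex-valued multistate signum function csgn is not a B-function with respect to the hyperbolic (Minkowski) bilinear form: for the resolution factor K = 4, there exist z ∈ D and s ∈ S with s ≠ csgn(z) such that B_h(s, z) ≥ B_h(csgn(z), z), where B_h(p,q) = p₀q₀ − p₁q₁ for p = p₀ + p₁ i and q = q₀ + q₁ i. -/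
open scoped Classical

/-- The hyperbolic (Minkowski) bilinear form `B_h(p,q) = p₀q₀ - p₁q₁` on hyperbolic
numbers identified with points of `ℝ² ≅ ℂ`. -/
def Bh (p q : ℂ) : ℝ := p.re * q.re - p.im * q.im

/-- For the resolution factor `K = 4`, the complex-valued multistate signum function is
not a `B`-function with respect to the hyperbolic (Minkowski) bilinear form. -/
theorem csgn_not_BFunction_minkowski (csgn : ℂ → ℂ) (hcsgn : IsCsgn 4 csgn) :
    ∃ z ∈ Dset 4, ∃ s ∈ Sset 4, s ≠ csgn z ∧ Bh (csgn z) z ≤ Bh s z := by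
  have hpi := Real.pi_pos
  have hD : Complex.I ∈ Dset 4 := by
    refine ⟨Complex.I_ne_zero, ?_⟩
    intro k h1 h2 h
    rw [arg2pi, Complex.arg_I, if_neg (by linarith)] at h
    have h3 : (2 * (k : ℝ) - 1) = 2 := by
      apply mul_right_cancel₀ hpi.ne'
      push_cast at h
      linarith
    have h4 : 2 * k = 3 := by
      have : (2 * (k : ℝ)) = 3 := by linarith
      exact_mod_cast this
    omega
  have hI : csgn Complex.I = Complex.I := by
    obtain ⟨⟨k, hk, hs⟩, h1, h2⟩ := hcsgn _ hD
    rw [Complex.exp_mul_I, ← Complex.ofReal_cos, ← Complex.ofReal_sin] at hs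
    push_cast at h1 h2
    interval_cases k
    · have e : csgn Complex.I = 1 := by rw [hs]; simp
      rw [e] at h2
      simp [Complex.arg_I] at h2
      linarith
    · rw [hs, show (2 * ((1 : ℕ) : ℝ) * (Real.pi / (4 : ℕ))) = Real.pi / 2 by push_cast; ring]
      simp
    · have e : csgn Complex.I = -1 := by
        rw [hs, show (2 * ((2 : ℕ) : ℝ) * (Real.pi / (4 : ℕ))) = Real.pi by push_cast; ring]
        simp
      rw [e] at h1
      simp [Complex.arg_neg_I] at h1
      linarith
    · have e : csgn Complex.I = -Complex.I := by
        rw [hs, show (2 * ((3 : ℕ) : ℝ) * (Real.pi / (4 : ℕ))) = Real.pi / 2 + Real.pi by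
          push_cast; ring, Real.cos_add_pi, Real.sin_add_pi]
        simp
      rw [e] at h2
      simp [Complex.arg_neg_one] at h2
      linarith
  refine ⟨Complex.I, hD, 1, ⟨0, by norm_num, by simp⟩, ?_, ?_⟩
  · rw [hI]
    intro h
    have := congrArg Complex.re h
    simp at this
  · rw [hI]
    simp [Bh]
end
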